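/- arXiv:0711.0312 — 2 statements merged into one kernel-verified Lean document; each statement's English description precedes it below -/
import Mathlib

section
/- (Rényi) Let κ_n = (1/|U_n|) · Σ_{f ∈ U_n} L(f) be the expected cycle length of a uniform random connected mapping on [n]. Then κ_n = √(2n/π) · (1 + O(1/√n)) as n → ∞. -/
open scoped Classical
open Function

namespace IterMap

noncomputable section

/-- A vertex `v` is cyclic for `f` if some positive iterate of `f` fixes `v`. -/
def IsCyclic {n : ℕ} (f : Fin n → Fin n) (v : Fin n) : Prop :=
  ∃ t, 0 < t ∧ f^[t] v = v

theorem isCyclic_apply {n : ℕ} {f : Fin n → Fin n} {v : Fin n} (h : IsCyclic f v) :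
    IsCyclic f (f v) := by
  obtain ⟨t, ht, hv⟩ := h
  refine ⟨t, ht, ?_⟩
  calc f^[t] (f v) = f^[t + 1] v := (Function.iterate_succ_apply f t v).symm
    _ = f (f^[t] v) := Function.iterate_succ_apply' f t v
    _ = f v := by rw [hv]

/-- The permutation induced by `f` on its cyclic vertices. -/
def cyclicPerm {n : ℕ} (f : Fin n → Fin n) :
    Equiv.Perm {v : Fin n // IsCyclic f v} :=
  Equiv.ofBijective (fun v => ⟨f v.1, isCyclic_apply v.2⟩) (by
    rw [← Finite.injective_iff_bijective]
    intro u v huv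
    have h1 : f u.1 = f v.1 := congrArg Subtype.val huv
    obtain ⟨s, hs, hsu⟩ := u.2
    obtain ⟨t, ht, htv⟩ := v.2
    have hu : f^[s * t] u.1 = u.1 := by
      rw [Function.iterate_mul]
      exact Function.iterate_fixed hsu t
    have hv : f^[s * t] v.1 = v.1 := by
      rw [mul_comm, Function.iterate_mul]
      exact Function.iterate_fixed htv s
    have hst : 0 < s * t := Nat.mul_pos hs ht
    obtain ⟨k, hk⟩ : ∃ k, s * t = k + 1 := ⟨s * t - 1, by omega⟩
    apply Subtype.ext
    calc u.1 = f^[s * t] u.1 := hu.symm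
      _ = f^[k] (f u.1) := by rw [hk, Function.iterate_succ_apply]
      _ = f^[k] (f v.1) := by rw [h1]
      _ = f^[s * t] v.1 := by rw [hk, Function.iterate_succ_apply]
      _ = v.1 := hv)

/-- `T f`: the (eventual) period of the sequence of iterates of `f`. -/
def T {n : ℕ} (f : Fin n → Fin n) : ℕ :=
  sInf {T : ℕ | 0 < T ∧ ∀ m, n ≤ m → f^[m + T] = f^[m]}

/-- `B f`: the product of the lengths of the cycles of `f`. -/
def B {n : ℕ} (f : Fin n → Fin n) : ℕ :=
  (cyclicPerm f).cycleType.prod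

/-- `Z f`: the number of cyclic vertices of `f`. -/
def Z {n : ℕ} (f : Fin n → Fin n) : ℕ :=
  Nat.card {v : Fin n // IsCyclic f v}

/-- `O f`: the number of distinct positive iterates of `f`. -/
def O {n : ℕ} (f : Fin n → Fin n) : ℕ :=
  Nat.card {g : Fin n → Fin n // ∃ t, 0 < t ∧ g = f^[t]}

/-- `f` is connected if its functional graph has one weak component. -/
def Connected {n : ℕ} (f : Fin n → Fin n) : Prop :=
  ∀ u v : Fin n, ∃ s t : ℕ, f^[s] u = f^[t] v

/-- The set of connected mappings on `[n]`. -/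
def Un (n : ℕ) : Finset (Fin n → Fin n) :=
  Finset.univ.filter fun f => Connected f

/-- `kappa n`: the average cycle length of a uniform random connected mapping. -/
def kappa (n : ℕ) : ℝ :=
  (∑ f ∈ Un n, (Z f : ℝ)) / (Un n).card

def c (d : ℕ) : ℝ :=
  ((kappa d - 1) / d) * Real.exp (-(d : ℝ)) *
    ∑ k ∈ Finset.range d, (d : ℝ) ^ k / (k.factorial : ℝ)

def F (z : ℝ) : ℝ := (1 / (1 - z)) * Real.exp (∑' d : ℕ, c d * z ^ d)

def mu (m : ℕ) : ℝ := iteratedDeriv m F 0 / (m.factorial : ℝ)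

def g (s : ℝ) : ℝ := ∑' d : ℕ, c d * Real.exp (-(d : ℝ) * s)

/-- `M m`: the average order of a uniform random permutation of `[m]`. -/
def M (m : ℕ) : ℝ :=
  (∑ σ : Equiv.Perm (Fin m), (orderOf σ : ℝ)) / (m.factorial : ℝ)

def I : ℝ :=
  ∫ t in Set.Ioi (0 : ℝ), Real.log (Real.log (Real.exp 1 / (1 - Real.exp (-t))))

def beta0 : ℝ := Real.sqrt (8 * I)

def k0 : ℝ := (3 / 2) * (3 * I) ^ ((2 : ℝ) / 3)

end


/-! ### Absorption counts -/

section absorb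
variable {V : Type}

inductive Hit (f : V → V) (T : Finset V) : V → V → Prop
  | base (u : V) : u ∈ T → Hit f T u u
  | step (u r : V) : u ∉ T → Hit f T (f u) r → Hit f T u r

theorem Hit.det {f : V → V} {T : Finset V} {u r r' : V} (h : Hit f T u r) (h' : Hit f T u r') :
    r = r' := by
  induction h with
  | base u hu =>
    cases h' with
    | base => rfl
    | step _ _ hn => exact absurd hu hn
  | step u r hn _ ih =>
    cases h' with
    | base _ hu => exact absurd hu hn
    | step _ _ _ h2 => exact ih h2

theorem Hit.mem {f : V → V} {T : Finset V} {u r : V} (h : Hit f T u r) : r ∈ T := by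
  induction h with
  | base u hu => exact hu
  | step u r hn _ ih => exact ih

theorem Hit.iter {f : V → V} {T : Finset V} {u r : V} (h : Hit f T u r) : ∃ t, f^[t] u = r := by
  induction h with
  | base u hu => exact ⟨0, rfl⟩
  | step u r hn _ ih =>
    obtain ⟨t, ht⟩ := ih
    exact ⟨t + 1, by rw [Function.iterate_succ_apply]; exact ht⟩

theorem Hit.congr {f g : V → V} {T : Finset V} {u r : V} (h : Hit f T u r)
    (hfg : ∀ x, x ∉ T → f x = g x) : Hit g T u r := by
  induction h with
  | base u hu => exact Hit.base u hu
  | step u r hn _ ih => exact Hit.step u r hn (by rw [← hfg u hn]; exact ih)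

theorem exists_hit {f : V → V} {T : Finset V} {u : V} {t : ℕ} (h : f^[t] u ∈ T) :
    ∃ r, Hit f T u r := by
  induction t generalizing u with
  | zero => exact ⟨u, Hit.base u h⟩
  | succ t ih =>
    rw [Function.iterate_succ_apply] at h
    obtain ⟨r, hr⟩ := ih h
    by_cases hu : u ∈ T
    · exact ⟨u, Hit.base u hu⟩
    · exact ⟨r, Hit.step u r hu hr⟩

def Reach (f : V → V) (S : Finset V) : Prop := ∀ u, ∃ t, f^[t] u ∈ S

theorem reach_iff {f : V → V} {S : Finset V} : Reach f S ↔ ∀ u, ∃ r, Hit f S u r := by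
  constructor
  · intro h u
    obtain ⟨t, ht⟩ := h u
    exact exists_hit ht
  · intro h u
    obtain ⟨r, hr⟩ := h u
    obtain ⟨t, ht⟩ := hr.iter
    exact ⟨t, by rw [ht]; exact hr.mem⟩

theorem Reach.congr {f g : V → V} {T : Finset V} (h : Reach f T)
    (hfg : ∀ x, x ∉ T → f x = g x) : Reach g T := by
  rw [reach_iff] at h ⊢
  intro u
  obtain ⟨r, hr⟩ := h u
  exact ⟨r, hr.congr hfg⟩

variable [DecidableEq V]

theorem Hit.erase_of_ne {f : V → V} {T : Finset V} {u b v : V} (h : Hit f T u b) (hb : b ≠ v) :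
    Hit f (T.erase v) u b := by
  induction h with
  | base u hu => exact Hit.base u (Finset.mem_erase.2 ⟨hb, hu⟩)
  | step u r hn _ ih => exact Hit.step u r (fun h => hn (Finset.mem_of_mem_erase h)) (ih hb)

theorem Hit.erase_trans {f : V → V} {T : Finset V} {u a v : V} (h : Hit f T u v)
    (ha : Hit f (T.erase v) (f v) a) : Hit f (T.erase v) u a := by
  induction h with
  | base u hu => exact Hit.step u a (Finset.notMem_erase u T) ha
  | step u r hn _ ih => exact Hit.step u a (fun h => hn (Finset.mem_of_mem_erase h)) (ih ha)

theorem not_reach_of_loop {f : V → V} {T : Finset V} {v : V} (hv : Hit f T (f v) v) (t : ℕ)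
    (u : V) (hu : Hit f T u v) : f^[t] u ∉ T.erase v := by
  induction t generalizing u with
  | zero =>
    intro h
    have h1 := (Hit.base (f := f) u (Finset.mem_of_mem_erase h)).det hu
    subst h1
    exact Finset.notMem_erase _ _ h
  | succ t ih =>
    rw [Function.iterate_succ_apply]
    apply ih
    cases hu with
    | base => exact hv
    | step _ _ _ h => exact h

theorem reach_erase_iff {f : V → V} {T : Finset V} {v a : V} (hR : Reach f T)
    (ha : Hit f T (f v) a) : Reach f (T.erase v) ↔ a ≠ v := by
  constructor
  · rintro h rfl
    obtain ⟨t, ht⟩ := h (f a)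
    exact not_reach_of_loop ha t _ ha ht
  · intro hav
    rw [reach_iff] at hR ⊢
    intro u
    obtain ⟨r, hr⟩ := hR u
    by_cases hrv : r = v
    · subst hrv
      exact ⟨a, hr.erase_trans (ha.erase_of_ne hav)⟩
    · exact ⟨r, hr.erase_of_ne hrv⟩

theorem Reach.mono {f : V → V} {S T : Finset V} (h : Reach f S) (hST : S ⊆ T) : Reach f T :=
  fun u => (h u).imp fun _ ht => hST ht

variable [Fintype V]

noncomputable def N (S : Finset V) : ℕ := (Finset.univ.filter fun f : V → V => Reach f S).card

theorem N_modular {T : Finset V} {v w : V} (hv : v ∈ T) (hw : w ∈ T) (hvw : v ≠ w) :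
    (N (T.erase v) : ℤ) + N (T.erase w) = N ((T.erase v).erase w) + N T := by
  let E : (V → V) → Prop := fun f => Reach f T ∧ Hit f T (f v) w ∧ Hit f T (f w) v
  let E' : (V → V) → Prop := fun f => Reach f T ∧ Hit f T (f v) v ∧ Hit f T (f w) w
  have hsum : ∑ f : V → V, (if E f then (1 : ℤ) else 0) = ∑ f : V → V, if E' f then (1 : ℤ) else 0 := by
    rw [← Equiv.sum_comp (Equiv.arrowCongr (Equiv.swap v w) (Equiv.refl V))]
    refine Finset.sum_congr rfl fun f _ => ?_
    have hg : ∀ x, x ∉ T → f x = (Equiv.arrowCongr (Equiv.swap v w) (Equiv.refl V) f) x := by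
      intro x hx
      have h1 : x ≠ v := fun h => hx (h ▸ hv)
      have h2 : x ≠ w := fun h => hx (h ▸ hw)
      simp [Equiv.arrowCongr, Equiv.swap_apply_of_ne_of_ne h1 h2]
    have hgv : (Equiv.arrowCongr (Equiv.swap v w) (Equiv.refl V) f) v = f w := by
      simp [Equiv.arrowCongr]
    have hgw : (Equiv.arrowCongr (Equiv.swap v w) (Equiv.refl V) f) w = f v := by
      simp [Equiv.arrowCongr]
    have : E (Equiv.arrowCongr (Equiv.swap v w) (Equiv.refl V) f) ↔ E' f := by
      simp only [E, E', hgv, hgw]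
      constructor
      · rintro ⟨h1, h2, h3⟩
        exact ⟨h1.congr fun x hx => (hg x hx).symm, h3.congr fun x hx => (hg x hx).symm,
          h2.congr fun x hx => (hg x hx).symm⟩
      · rintro ⟨h1, h2, h3⟩
        exact ⟨h1.congr hg, h3.congr hg, h2.congr hg⟩
    simp only [this]
  have hpt : ∀ f : V → V, ((if Reach f (T.erase v) then (1 : ℤ) else 0) +
      (if Reach f (T.erase w) then (1 : ℤ) else 0)) + (if E' f then (1 : ℤ) else 0) =
      ((if Reach f ((T.erase v).erase w) then (1 : ℤ) else 0) + (if Reach f T then (1 : ℤ) else 0))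
      + (if E f then (1 : ℤ) else 0) := by
    intro f
    by_cases hR : Reach f T
    · obtain ⟨a, ha⟩ := reach_iff.1 hR (f v)
      obtain ⟨b, hb⟩ := reach_iff.1 hR (f w)
      have e1 : E f ↔ a = w ∧ b = v := by
        simp only [E, hR, true_and]
        constructor
        · rintro ⟨h1, h2⟩; exact ⟨ha.det h1, hb.det h2⟩
        · rintro ⟨rfl, rfl⟩; exact ⟨ha, hb⟩
      have e2 : E' f ↔ a = v ∧ b = w := by
        simp only [E', hR, true_and]
        constructor
        · rintro ⟨h1, h2⟩; exact ⟨ha.det h1, hb.det h2⟩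
        · rintro ⟨rfl, rfl⟩; exact ⟨ha, hb⟩
      have e3 := reach_erase_iff hR ha
      have e4 := reach_erase_iff hR hb
      have e5 : Reach f ((T.erase v).erase w) ↔ a ≠ v ∧ b ≠ w ∧ ¬ (b = v ∧ a = w) := by
        by_cases hav : a = v
        · have : ¬ Reach f (T.erase v) := by rw [e3]; simpa using hav
          simp only [hav, ne_eq, not_true_eq_false, false_and, iff_false]
          exact fun h => this (h.mono (Finset.erase_subset _ _))
        · have hR' := e3.2 hav
          by_cases hbv : b = v
          · have h1 : Hit f (T.erase v) (f w) a := by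
              subst hbv
              exact hb.erase_trans (ha.erase_of_ne hav)
            rw [reach_erase_iff hR' h1]
            subst hbv
            simp [hav, hvw]
          · rw [reach_erase_iff hR' (hb.erase_of_ne hbv)]
            simp [hav, hbv]
      simp only [e1, e2, e3, e4, e5, hR]
      by_cases h1 : a = v <;> by_cases h2 : b = w <;> by_cases h3 : a = w <;> by_cases h4 : b = v <;>
        simp_all
    · have h1 : ¬ Reach f (T.erase v) := fun h => hR (h.mono (Finset.erase_subset _ _))
      have h2 : ¬ Reach f (T.erase w) := fun h => hR (h.mono (Finset.erase_subset _ _))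
      have h3 : ¬ Reach f ((T.erase v).erase w) := fun h => h1 (h.mono (Finset.erase_subset _ _))
      simp [E, E', hR, h1, h2, h3]
  have := Finset.sum_congr (rfl : (Finset.univ : Finset (V → V)) = Finset.univ) fun f _ => hpt f
  simp only [Finset.sum_add_distrib] at this
  simp only [N, Finset.natCast_card_filter]
  linarith

theorem N_empty [Nonempty V] : N (∅ : Finset V) = 0 := by
  rw [N, Finset.card_eq_zero, Finset.filter_eq_empty_iff]
  intro f _ h
  obtain ⟨t, ht⟩ := h (Classical.arbitrary V)
  simp at ht

theorem N_univ : N (Finset.univ : Finset V) = Fintype.card V ^ Fintype.card V := by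
  rw [N, Finset.filter_true_of_mem]
  · simp
  · intro f _ u
    exact ⟨0, Finset.mem_univ _⟩

theorem N_add [Nonempty V] (S : Finset V) : (N S : ℤ) = ∑ v ∈ S, (N ({v} : Finset V) : ℤ) := by
  induction S using Finset.strongInduction with
  | H S ih =>
    rcases S.eq_empty_or_nonempty with rfl | ⟨v, hv⟩
    · simp [N_empty]
    · rcases (S.erase v).eq_empty_or_nonempty with h | ⟨w, hw⟩
      · have : S = {v} := by
          rw [← Finset.insert_erase hv, h]; rfl
        subst this
        simp
      · have hw' := Finset.mem_of_mem_erase hw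
        have hvw : v ≠ w := (Finset.ne_of_mem_erase hw).symm
        have h := N_modular hv hw' hvw
        have s1 := Finset.erase_ssubset hv
        have s2 := Finset.erase_ssubset hw'
        have s3 := (Finset.erase_ssubset hw).trans s1
        rw [ih _ s1, ih _ s2, ih _ s3] at h
        have t1 := Finset.add_sum_erase S (fun v => (N ({v} : Finset V) : ℤ)) hv
        have t2 := Finset.add_sum_erase S (fun v => (N ({v} : Finset V) : ℤ)) hw'
        have t3 := Finset.add_sum_erase (S.erase v) (fun v => (N ({v} : Finset V) : ℤ)) hw
        linarith

theorem N_singleton_eq (u v : V) : N ({u} : Finset V) = N ({v} : Finset V) := by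
  let σ := Equiv.swap u v
  have hσσ : ∀ x, σ (σ x) = x := fun x => Equiv.swap_apply_self u v x
  let Φ : (V → V) ≃ (V → V) := Equiv.arrowCongr σ σ
  have hΦ : ∀ f x, Φ f x = σ (f (σ x)) := fun f x => by
    simp [Φ, Equiv.arrowCongr, σ]
  have key : ∀ (f : V → V) (t : ℕ) (x : V), (Φ f)^[t] x = σ (f^[t] (σ x)) := by
    intro f t
    induction t with
    | zero => intro x; simp [hσσ]
    | succ t ih =>
      intro x
      rw [Function.iterate_succ_apply, Function.iterate_succ_apply, ih, hΦ, hσσ]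
  have hR : ∀ f, Reach f {u} ↔ Reach (Φ f) {v} := by
    intro f
    have hv : ∀ y, σ y = v ↔ y = u := by
      intro y
      rw [← Equiv.swap_apply_left u v]
      exact σ.injective.eq_iff
    simp only [Reach, Finset.mem_singleton, key, hv]
    exact ⟨fun h x => h (σ x), fun h x => by simpa [hσσ] using h (σ x)⟩
  unfold N
  refine Finset.card_bij (fun f _ => Φ f) ?_ ?_ ?_
  · intro f hf
    simpa [hR] using hf
  · intro f _ g _ h
    exact Φ.injective h
  · intro g hg
    refine ⟨Φ.symm g, ?_, by simp⟩
    simpa [hR] using hg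

theorem N_eq [Nonempty V] (S : Finset V) :
    (N S : ℝ) = S.card * (Fintype.card V : ℝ) ^ Fintype.card V / Fintype.card V := by
  obtain ⟨v⟩ := (inferInstance : Nonempty V)
  have h1 : ∀ S : Finset V, (N S : ℝ) = S.card * N ({v} : Finset V) := by
    intro S
    have := N_add S
    rw [Finset.sum_congr rfl fun w _ => by rw [N_singleton_eq w v], Finset.sum_const] at this
    have h2 : (N S : ℝ) = ((N S : ℤ) : ℝ) := by push_cast; rfl
    rw [h2, this]; simp
  have h2 := h1 Finset.univ
  rw [N_univ, Finset.card_univ] at h2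
  have hc : (Fintype.card V : ℝ) ≠ 0 := by
    have := Fintype.card_pos (α := V)
    positivity
  rw [h1 S]
  push_cast at h2
  rw [eq_div_iff hc, h2]
  ring

end absorb

/-! ### Counting connected maps -/

theorem card_fiber {V : Type} [DecidableEq V] [Fintype V] {k : ℕ} (e : Fin k ↪ V) (p : Fin k → V) :
    (Finset.univ.filter fun f : V → V =>
      Reach f (Finset.univ.map e) ∧ ∀ i, f (e i) = p i).card * Fintype.card V ^ k
      = N (Finset.univ.map e) := by
  have hc : Fintype.card (Fin k → V) = Fintype.card V ^ k := by simp
  rw [← hc, ← Finset.card_univ (α := Fin k → V), ← Finset.card_product, N]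
  have hcongr : ∀ (f : V → V) (q : Fin k → V), Reach f (Finset.univ.map e) →
      Reach (Function.extend e q f) (Finset.univ.map e) := by
    intro f q h
    refine h.congr fun x hx => ?_
    rw [Function.extend_apply']
    rintro ⟨a, rfl⟩
    exact hx (by simp)
  have hext : ∀ (f : V → V) (q : Fin k → V) (i : Fin k), Function.extend e q f (e i) = q i :=
    fun f q i => e.injective.extend_apply q f i
  have hext' : ∀ (f : V → V) (q r : Fin k → V), (∀ i, f (e i) = r i) →
      Function.extend e r (Function.extend e q f) = f := by
    intro f q r h
    funext x
    by_cases hx : ∃ a, e a = x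
    · obtain ⟨a, rfl⟩ := hx
      rw [hext, h]
    · rw [Function.extend_apply' _ _ _ hx, Function.extend_apply' _ _ _ hx]
  refine Finset.card_bij' (fun x _ => Function.extend e x.2 x.1)
    (fun f _ => (Function.extend e p f, fun i => f (e i))) ?_ ?_ ?_ ?_
  · rintro ⟨f, q⟩ h
    simp only [Finset.mem_product, Finset.mem_filter, Finset.mem_univ, true_and, and_true] at h ⊢
    exact hcongr _ _ h.1
  · intro f h
    simp only [Finset.mem_product, Finset.mem_filter, Finset.mem_univ, true_and, and_true] at h ⊢
    exact ⟨hcongr _ _ h, hext _ _⟩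
  · rintro ⟨f, q⟩ h
    simp only [Finset.mem_product, Finset.mem_filter, Finset.mem_univ, true_and, and_true] at h
    simp only [Prod.mk.injEq]
    exact ⟨hext' _ _ _ h.2, funext fun i => hext _ _ _⟩
  · intro f h
    exact hext' _ _ _ fun i => rfl

def Cyc {n m : ℕ} (f : Fin n → Fin n) (e : Fin (m + 1) ↪ Fin n) : Prop :=
  Reach f (Finset.univ.map e) ∧ ∀ i, f (e i) = e (i + 1)

theorem Z_eq {n : ℕ} (f : Fin n → Fin n) :
    Z f = (Finset.univ.filter fun v => IsCyclic f v).card := by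
  rw [Z, Nat.card_eq_fintype_card, Fintype.card_subtype]

theorem reach_singleton_iff {n : ℕ} (f : Fin n → Fin n) (v : Fin n) :
    Reach f {v} ↔ Connected f ∧ IsCyclic f v := by
  simp only [Reach, Finset.mem_singleton]
  constructor
  · intro h
    refine ⟨fun a b => ?_, ?_⟩
    · obtain ⟨s, hs⟩ := h a
      obtain ⟨t, ht⟩ := h b
      exact ⟨s, t, hs.trans ht.symm⟩
    · obtain ⟨s, hs⟩ := h (f v)
      exact ⟨s + 1, Nat.succ_pos _, by rw [Function.iterate_succ_apply]; exact hs⟩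
  · rintro ⟨hc, p, hp, hv⟩ u
    obtain ⟨s, t, h⟩ := hc u v
    refine ⟨(p * t - t) + s, ?_⟩
    rw [Function.iterate_add_apply, h, ← Function.iterate_add_apply,
      Nat.sub_add_cancel (Nat.le_mul_of_pos_left t hp), Function.iterate_mul]
    exact Function.iterate_fixed hv t

theorem Cyc.iter {n m : ℕ} {f : Fin n → Fin n} {e : Fin (m + 1) ↪ Fin n} (h : Cyc f e)
    (i : Fin (m + 1)) (t : ℕ) : f^[t] (e i) = e (i + Fin.ofNat (m + 1) t) := by
  induction t with
  | zero => simp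
  | succ t ih =>
    rw [Function.iterate_succ_apply', ih, h.2]
    congr 1
    ext
    simp [Fin.val_add, add_assoc]

theorem Cyc.isCyclic_iff {n m : ℕ} {f : Fin n → Fin n} {e : Fin (m + 1) ↪ Fin n} (h : Cyc f e)
    (v : Fin n) : IsCyclic f v ↔ v ∈ Finset.univ.map e := by
  constructor
  · rintro ⟨p, hp, hv⟩
    obtain ⟨t, ht⟩ := h.1 v
    simp only [Finset.mem_map, Finset.mem_univ, true_and] at ht ⊢
    obtain ⟨i, hi⟩ := ht
    have h1 := h.iter i (p * t - t)
    rw [hi, ← Function.iterate_add_apply,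
      Nat.sub_add_cancel (Nat.le_mul_of_pos_left t hp), Function.iterate_mul,
      Function.iterate_fixed hv t] at h1
    exact ⟨_, h1.symm⟩
  · intro hv
    simp only [Finset.mem_map, Finset.mem_univ, true_and] at hv
    obtain ⟨i, rfl⟩ := hv
    exact ⟨m + 1, Nat.succ_pos _, by rw [h.iter]; congr 1; ext; simp⟩

theorem Cyc.Z_eq {n m : ℕ} {f : Fin n → Fin n} {e : Fin (m + 1) ↪ Fin n} (h : Cyc f e) :
    Z f = m + 1 := by
  rw [IterMap.Z_eq, Finset.filter_congr fun v _ => h.isCyclic_iff v, Finset.filter_univ_mem, Finset.card_map]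
  simp

theorem Cyc.reach {n m : ℕ} {f : Fin n → Fin n} {e : Fin (m + 1) ↪ Fin n} (h : Cyc f e) :
    Reach f {e 0} := by
  intro u
  obtain ⟨t, ht⟩ := h.1 u
  simp only [Finset.mem_map, Finset.mem_univ, true_and] at ht
  obtain ⟨i, hi⟩ := ht
  refine ⟨((-i : Fin (m + 1)) : ℕ) + t, ?_⟩
  rw [Function.iterate_add_apply, ← hi, h.iter, Finset.mem_singleton]
  congr 1
  rw [Fin.ofNat_eq_cast, Fin.cast_val_eq_self]
  simp

theorem exists_Cyc {n m : ℕ} {f : Fin n → Fin n} {v : Fin n} (h : Reach f {v})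
    (hZ : Z f = m + 1) : ∃ e : Fin (m + 1) ↪ Fin n, Cyc f e ∧ e 0 = v := by
  obtain ⟨hc, hv⟩ := (reach_singleton_iff f v).1 h
  have hper : v ∈ Function.periodicPts f := by
    obtain ⟨p, hp, hpv⟩ := hv
    exact ⟨p, hp, hpv⟩
  have hpos := Function.minimalPeriod_pos_of_mem_periodicPts hper
  set p := Function.minimalPeriod f v with hp
  have hinj : Set.InjOn (fun i => f^[i] v) (Set.Iio p) :=
    Function.iterate_injOn_Iio_minimalPeriod
  have hmod : ∀ t, f^[t % p] v = f^[t] v := fun t => Function.iterate_mod_minimalPeriod_eq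
  have hset : (Finset.univ.filter fun v => IsCyclic f v) =
      (Finset.range p).image fun i => f^[i] v := by
    ext u
    simp only [Finset.mem_filter, Finset.mem_univ, true_and, Finset.mem_image, Finset.mem_range]
    constructor
    · intro hu
      obtain ⟨t, ht⟩ := ((reach_singleton_iff f u).2 ⟨hc, hu⟩) v
      rw [Finset.mem_singleton] at ht
      exact ⟨t % p, Nat.mod_lt _ hpos, by rw [hmod, ht]⟩
    · rintro ⟨i, _, rfl⟩
      refine ⟨p, hpos, ?_⟩
      rw [← Function.iterate_add_apply, add_comm, Function.iterate_add_apply,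
        Function.iterate_minimalPeriod]
  have hpm : p = m + 1 := by
    rw [← hZ, Z_eq, hset, Finset.card_image_of_injOn, Finset.card_range]
    intro i hi j hj hij
    exact hinj (by simpa using hi) (by simpa using hj) hij
  have hinj2 : Function.Injective fun i : Fin (m + 1) => f^[(i : ℕ)] v := by
    intro i j hij
    exact Fin.ext (hinj (by simp only [Set.mem_Iio, hpm]; omega)
      (by simp only [Set.mem_Iio, hpm]; omega) hij)
  refine ⟨⟨fun i => f^[(i : ℕ)] v, hinj2⟩, ⟨?_, ?_⟩, rfl⟩
  · refine h.mono ?_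
    intro x hx
    rw [Finset.mem_singleton] at hx
    simp only [Finset.mem_map, Finset.mem_univ, true_and]
    exact ⟨0, hx.symm⟩
  · intro i
    change f (f^[(i : ℕ)] v) = f^[((i + 1 : Fin (m + 1)) : ℕ)] v
    rw [← Function.iterate_succ_apply' f, ← hmod (i.1 + 1), hpm, Fin.val_add]
    simp [Nat.add_mod]

theorem card_Cyc {n m : ℕ} (f : Fin n → Fin n) :
    (Finset.univ.filter fun e : Fin (m + 1) ↪ Fin n => Cyc f e).card =
      if Connected f ∧ Z f = m + 1 then m + 1 else 0 := by
  split_ifs with h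
  · refine Eq.trans ?_ ((Z_eq f).symm.trans h.2)
    refine Finset.card_bij (fun e _ => e 0) ?_ ?_ ?_
    · intro e he
      simp only [Finset.mem_filter, Finset.mem_univ, true_and] at he ⊢
      exact ((reach_singleton_iff f _).1 he.reach).2
    · intro e he e' he' h0
      simp only [Finset.mem_filter, Finset.mem_univ, true_and] at he he'
      ext i
      have h1 := he.iter 0 i
      have h2 := he'.iter 0 i
      rw [h0, h2] at h1
      simp at h1
      rw [h1]
    · intro v hv
      simp only [Finset.mem_filter, Finset.mem_univ, true_and] at hv
      obtain ⟨e, he, hev⟩ := exists_Cyc ((reach_singleton_iff f v).2 ⟨h.1, hv⟩) h.2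
      exact ⟨e, by simpa using he, hev⟩
  · rw [Finset.card_eq_zero, Finset.filter_eq_empty_iff]
    intro e _ he
    exact h ⟨((reach_singleton_iff f _).1 he.reach).1, he.Z_eq⟩

theorem Z_le {n : ℕ} (f : Fin n → Fin n) : Z f ≤ n := by
  rw [Z_eq]
  exact (Finset.card_le_univ _).trans (by simp)

theorem Z_pos {n : ℕ} (hn : 0 < n) (f : Fin n → Fin n) : 0 < Z f := by
  rw [Z_eq, Finset.card_pos]
  have hni : ¬ Function.Injective fun t : ℕ => f^[t] ⟨0, hn⟩ := not_injective_infinite_finite _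
  simp only [Function.Injective, not_forall] at hni
  obtain ⟨s, t, hst, hne⟩ := hni
  wlog hlt : s < t generalizing s t
  · exact this t s hst.symm (Ne.symm hne) (by omega)
  refine ⟨f^[s] ⟨0, hn⟩, ?_⟩
  simp only [Finset.mem_filter, Finset.mem_univ, true_and]
  refine ⟨t - s, by omega, ?_⟩
  rw [← Function.iterate_add_apply, Nat.sub_add_cancel hlt.le]
  exact hst.symm

theorem sum_Z {n : ℕ} (hn : 0 < n) : ∑ f ∈ Un n, (Z f : ℝ) = (n : ℝ) ^ n := by
  have : Nonempty (Fin n) := ⟨⟨0, hn⟩⟩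
  have h1 : ∑ f ∈ Un n, (Z f : ℝ) = ∑ v : Fin n, (N ({v} : Finset (Fin n)) : ℝ) := by
    simp only [N, Finset.natCast_card_filter, Un, Finset.sum_filter]
    rw [Finset.sum_comm]
    refine Finset.sum_congr rfl fun f _ => ?_
    simp only [reach_singleton_iff]
    by_cases hc : Connected f
    · simp only [hc, if_true, true_and, Z_eq, Finset.natCast_card_filter]
    · simp [hc]
  rw [h1]
  simp only [N_eq, Finset.card_singleton, Finset.sum_const, Finset.card_univ, Fintype.card_fin]
  have : (n : ℝ) ≠ 0 := by positivity
  rw [nsmul_eq_mul, Nat.cast_one, one_mul, mul_div_cancel₀ _ this]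

theorem card_Un {n : ℕ} (hn : 0 < n) : ((Un n).card : ℝ) =
    (n : ℝ) ^ n / n * ∑ m ∈ Finset.range n, (n.descFactorial (m + 1) : ℝ) / (n : ℝ) ^ (m + 1) := by
  have : Nonempty (Fin n) := ⟨⟨0, hn⟩⟩
  have hn0 : (n : ℝ) ≠ 0 := by positivity
  have h1 : ((Un n).card : ℝ) = ∑ f : Fin n → Fin n, ∑ m ∈ Finset.range n,
      (1 / ((m : ℝ) + 1)) * ∑ e : Fin (m + 1) ↪ Fin n, if Cyc f e then (1 : ℝ) else 0 := by
    rw [Un, Finset.natCast_card_filter]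
    refine Finset.sum_congr rfl fun f _ => ?_
    simp only [← Finset.natCast_card_filter, card_Cyc]
    by_cases hc : Connected f
    · rw [Finset.sum_eq_single (Z f - 1)]
      · have := Z_pos hn f
        have h2 : Z f - 1 + 1 = Z f := by omega
        have h3 : ((Z f - 1 : ℕ) : ℝ) + 1 = Z f := by exact_mod_cast h2
        rw [h2, h3]
        have : (Z f : ℝ) ≠ 0 := by positivity
        simp [hc, this]
      · intro m _ hm
        have : ¬ (Z f = m + 1) := by omega
        simp [this]
      · intro h
        have := Z_pos hn f
        have := Z_le f
        exact absurd (Finset.mem_range.2 (by omega)) h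
    · simp [hc]
  rw [h1, Finset.sum_comm, Finset.mul_sum]
  refine Finset.sum_congr rfl fun m _ => ?_
  rw [← Finset.mul_sum, Finset.sum_comm]
  have h2 : ∀ e : Fin (m + 1) ↪ Fin n, ∑ f : Fin n → Fin n, (if Cyc f e then (1 : ℝ) else 0) =
      ((m : ℝ) + 1) * (n : ℝ) ^ n / n / (n : ℝ) ^ (m + 1) := by
    intro e
    have h3 := card_fiber e (fun i => e (i + 1))
    have h4 : ((N (Finset.univ.map e) : ℕ) : ℝ) = _ := N_eq (Finset.univ.map e)
    rw [← h3] at h4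
    rw [← Finset.natCast_card_filter, eq_div_iff (by positivity)]
    simp only [Fintype.card_fin, Finset.card_map, Finset.card_univ] at h4
    push_cast at h4
    convert h4
    rfl
  simp only [h2, Finset.sum_const, Finset.card_univ, Fintype.card_embedding_eq, Fintype.card_fin,
    nsmul_eq_mul]
  have : (m : ℝ) + 1 ≠ 0 := by positivity
  field_simp

noncomputable def Q (n : ℕ) : ℝ := ∑ m ∈ Finset.range n, (n.descFactorial (m + 1) : ℝ) / (n : ℝ) ^ (m + 1)

theorem kappa_eq {n : ℕ} (hn : 0 < n) : kappa n = n / Q n := by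
  rw [kappa, sum_Z hn, card_Un hn, ← Q]
  have hn0 : (n : ℝ) ≠ 0 := by positivity
  have : (n : ℝ) ^ n ≠ 0 := by positivity
  generalize (n : ℝ) ^ n = x at *
  by_cases hq : Q n = 0
  · simp [hq]
  · field_simp

/-! ### Asymptotics of `Q` -/

noncomputable def qa (n k : ℕ) : ℝ := (n.descFactorial k : ℝ) / (n : ℝ) ^ k

theorem qa_zero (n : ℕ) : qa n 0 = 1 := by simp [qa]

theorem qa_nonneg (n k : ℕ) : 0 ≤ qa n k := by unfold qa; positivity

theorem qa_succ {n k : ℕ} (hn : 0 < n) (hk : k ≤ n) : qa n (k + 1) = qa n k * (1 - k / n) := by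
  have hn0 : (n : ℝ) ≠ 0 := by positivity
  unfold qa
  rw [Nat.descFactorial_succ]
  push_cast [Nat.cast_sub hk]
  field_simp
  ring

theorem qa_of_lt {n k : ℕ} (h : n < k) : qa n k = 0 := by
  simp [qa, Nat.descFactorial_of_lt h]

theorem qa_le {n m : ℕ} (hn : 0 < n) (hm : m < n) :
    qa n (m + 1) ≤ Real.exp (-((m : ℝ) * (m + 1) / (2 * n))) := by
  have hn0 : (0 : ℝ) < n := by positivity
  induction m with
  | zero => rw [qa_succ hn (by omega), qa_zero]; simp
  | succ m ih =>
    rw [qa_succ hn (by omega)]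
    have h1 := ih (by omega)
    have h2 : 1 - ((m + 1 : ℕ) : ℝ) / n ≤ Real.exp (-(((m + 1 : ℕ) : ℝ) / n)) :=
      Real.one_sub_le_exp_neg _
    have h3 : 0 ≤ 1 - ((m + 1 : ℕ) : ℝ) / n := by
      rw [sub_nonneg, div_le_one hn0]
      exact_mod_cast hm.le
    refine (mul_le_mul h1 h2 h3 (Real.exp_pos _).le).trans (le_of_eq ?_)
    rw [← Real.exp_add]
    congr 1
    push_cast
    field_simp
    ring

theorem antitone_gauss {b : ℝ} (hb : 0 < b) (s : Set ℝ) (hs : s ⊆ Set.Ici 0) :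
    AntitoneOn (fun x : ℝ => Real.exp (-b * x ^ 2)) s := by
  intro x hx y hy hxy
  have hx0 : 0 ≤ x := hs hx
  apply Real.exp_le_exp.2
  have : x ^ 2 ≤ y ^ 2 := by gcongr
  nlinarith

theorem sum_gauss_le {b : ℝ} (hb : 0 < b) (M : ℕ) :
    ∑ m ∈ Finset.range M, Real.exp (-b * ((m : ℝ) + 1) ^ 2) ≤ √(Real.pi / b) / 2 := by
  have h := AntitoneOn.sum_le_integral (x₀ := 0) (a := M)
    (antitone_gauss hb (Set.Icc 0 (0 + (M : ℝ))) (fun x hx => hx.1))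
  rw [← integral_gaussian_Ioi b]
  have h2 : ∫ x in (0 : ℝ)..0 + M, Real.exp (-b * x ^ 2) ≤
      ∫ x in Set.Ioi (0 : ℝ), Real.exp (-b * x ^ 2) := by
    rw [intervalIntegral.integral_of_le (by positivity)]
    refine MeasureTheory.setIntegral_mono_set (integrable_exp_neg_mul_sq hb).integrableOn ?_ ?_
    · exact Filter.Eventually.of_forall fun x => (Real.exp_pos _).le
    · exact (Set.Ioc_subset_Ioi_self).eventuallyLE
  refine le_trans (le_of_eq ?_) (h.trans h2)
  refine Finset.sum_congr rfl fun m _ => ?_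
  push_cast
  simp

theorem Q_le {n : ℕ} (hn : 0 < n) : Q n ≤ √(Real.pi * n / 2) + 1 := by
  have hn0 : (0 : ℝ) < n := by positivity
  have hb : (0 : ℝ) < 1 / (2 * n) := by positivity
  have h1 : Q n ≤ ∑ m ∈ Finset.range n, Real.exp (-(1 / (2 * n)) * (m : ℝ) ^ 2) := by
    refine Finset.sum_le_sum fun m hm => ?_
    refine (qa_le hn (Finset.mem_range.1 hm)).trans (Real.exp_le_exp.2 ?_)
    have h3 : (m : ℝ) ^ 2 / (2 * n) ≤ (m : ℝ) * (m + 1) / (2 * n) := by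
      gcongr
      nlinarith [(Nat.cast_nonneg m : (0 : ℝ) ≤ m)]
    calc _ ≤ -((m : ℝ) ^ 2 / (2 * n)) := neg_le_neg h3
      _ = _ := by ring
  obtain ⟨k, rfl⟩ : ∃ k, n = k + 1 := ⟨n - 1, by omega⟩
  rw [Finset.sum_range_succ'] at h1
  have h2 := sum_gauss_le hb k
  have h3 : √(Real.pi / (1 / (2 * ((k + 1 : ℕ) : ℝ)))) / 2 = √(Real.pi * ((k + 1 : ℕ) : ℝ) / 2) := by
    rw [div_eq_iff (by norm_num), eq_comm, ← Real.sqrt_sq (by norm_num : (0 : ℝ) ≤ 2),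
      ← Real.sqrt_mul (by positivity), Real.sqrt_sq (by norm_num)]
    congr 1
    field_simp
  rw [h3] at h2
  push_cast at h1 h2 ⊢
  simp only [ne_eq, OfNat.ofNat_ne_zero, not_false_eq_true, zero_pow, mul_zero, Real.exp_zero] at h1
  linarith

theorem exp_le_one_sub {x : ℝ} (h0 : 0 ≤ x) (h1 : x ≤ 1 / 2) :
    Real.exp (-(x + 2 * x ^ 2)) ≤ 1 - x := by
  rw [Real.exp_neg]
  have h := Real.add_one_le_exp (x + 2 * x ^ 2)
  rw [inv_le_comm₀ (Real.exp_pos _) (by linarith)]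
  refine le_trans ?_ h
  rw [inv_eq_one_div, div_le_iff₀ (by linarith)]
  nlinarith [mul_nonneg (sq_nonneg x) (by linarith : 0 ≤ 1 - 2 * x)]

theorem le_qa {n k : ℕ} (hn : 0 < n) (hk : 2 * k ≤ n) :
    Real.exp (-((k : ℝ) ^ 2 / (2 * n) + (k : ℝ) ^ 3 / n ^ 2)) ≤ qa n k := by
  have hn0 : (0 : ℝ) < n := by positivity
  induction k with
  | zero => simp [qa_zero]
  | succ k ih =>
    rw [qa_succ hn (by omega)]
    have h1 := ih (by omega)
    have hkn : (2 : ℝ) * k ≤ n := by exact_mod_cast (by omega : 2 * k ≤ n)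
    have h2 := exp_le_one_sub (x := (k : ℝ) / n) (by positivity)
      (by rw [div_le_iff₀ hn0]; linarith)
    refine le_trans ?_ (mul_le_mul h1 h2 (Real.exp_pos _).le (qa_nonneg _ _))
    rw [← Real.exp_add]
    apply Real.exp_le_exp.2
    have hk0 : (0 : ℝ) ≤ k := Nat.cast_nonneg k
    have e1 : (k : ℝ) ^ 2 / (2 * n) + k / n ≤ (((k + 1 : ℕ) : ℝ)) ^ 2 / (2 * n) := by
      rw [div_add_div _ _ (by positivity) (by positivity), div_le_div_iff₀ (by positivity) (by positivity)]
      push_cast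
      have : 0 < (n : ℝ) ^ 2 := by positivity
      nlinarith
    have e2 : (k : ℝ) ^ 3 / n ^ 2 + 2 * ((k : ℝ) / n) ^ 2 ≤ (((k + 1 : ℕ) : ℝ)) ^ 3 / n ^ 2 := by
      rw [div_pow, ← mul_div_assoc, ← add_div]
      push_cast
      gcongr
      nlinarith [sq_nonneg (k : ℝ)]
    linarith

theorem le_qa' {n : ℕ} (hn : 8 ≤ n) (k : ℕ) :
    Real.exp (-((k : ℝ) ^ 2 / (2 * n))) * (1 - (k : ℝ) ^ 3 / n ^ 2) ≤ qa n k := by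
  have hn0 : (0 : ℝ) < n := by exact_mod_cast (by omega : 0 < n)
  by_cases hk : 2 * k ≤ n
  · refine le_trans ?_ (le_qa (by omega) hk)
    rw [neg_add, Real.exp_add]
    gcongr
    exact Real.one_sub_le_exp_neg _
  · refine le_trans (mul_nonpos_of_nonneg_of_nonpos (Real.exp_pos _).le ?_) (qa_nonneg _ _)
    rw [sub_nonpos, le_div_iff₀ (by positivity), one_mul]
    have h1 : (n : ℝ) ≤ 2 * k := by exact_mod_cast (by omega : n ≤ 2 * k)
    have h2 : (8 : ℝ) ≤ n := by exact_mod_cast hn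
    have h3 : (n : ℝ) ^ 3 ≤ (2 * k) ^ 3 := by gcongr
    nlinarith [mul_nonneg (sq_nonneg (n : ℝ)) (by linarith : 0 ≤ (n : ℝ) - 8)]

theorem cube_le (y : ℝ) (hy : 0 ≤ y) : y ^ 3 ≤ 33 * Real.exp (y ^ 2 / 4) := by
  have h := Real.quadratic_le_exp_of_nonneg (x := y ^ 2 / 4) (by positivity)
  have h2 : y ^ 3 ≤ 1 + y ^ 4 := by
    nlinarith [sq_nonneg (y ^ 2 - y), sq_nonneg (y ^ 2), sq_nonneg (y - 1), sq_nonneg (y ^ 2 - 1)]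
  nlinarith [sq_nonneg y]

theorem err_le {n : ℕ} (hn : 0 < n) (k : ℕ) :
    Real.exp (-((k : ℝ) ^ 2 / (2 * n))) * ((k : ℝ) ^ 3 / n ^ 2) ≤
      33 / √n * Real.exp (-(1 / (4 * n)) * (k : ℝ) ^ 2) := by
  have hn0 : (0 : ℝ) < n := by positivity
  obtain ⟨s, hs, hsn⟩ : ∃ s : ℝ, 0 < s ∧ (n : ℝ) = s ^ 2 :=
    ⟨√n, Real.sqrt_pos.2 hn0, (Real.sq_sqrt hn0.le).symm⟩
  rw [hsn, Real.sqrt_sq hs.le]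
  have h := cube_le ((k : ℝ) / s) (by positivity)
  have e1 : -((k : ℝ) ^ 2 / (2 * s ^ 2)) = -(1 / (4 * s ^ 2)) * (k : ℝ) ^ 2 + -(((k : ℝ) / s) ^ 2 / 4) := by
    field_simp
    ring
  have e2 : (k : ℝ) ^ 3 / (s ^ 2) ^ 2 = ((k : ℝ) / s) ^ 3 / s := by
    field_simp
  rw [e1, e2, Real.exp_add, Real.exp_neg (((k : ℝ) / s) ^ 2 / 4)]
  have hE := Real.exp_pos (((k : ℝ) / s) ^ 2 / 4)
  set E := Real.exp (((k : ℝ) / s) ^ 2 / 4)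
  have h3 : E⁻¹ * (((k : ℝ) / s) ^ 3 / s) ≤ 33 / s := by
    rw [← mul_div_assoc]
    gcongr
    rw [inv_mul_le_iff₀ hE]
    linarith
  calc _ = Real.exp (-(1 / (4 * s ^ 2)) * (k : ℝ) ^ 2) * (E⁻¹ * (((k : ℝ) / s) ^ 3 / s)) := by ring
    _ ≤ Real.exp (-(1 / (4 * s ^ 2)) * (k : ℝ) ^ 2) * (33 / s) := by gcongr
    _ = _ := by ring

theorem Q_ge {n : ℕ} (hn : 8 ≤ n) : √(Real.pi * n / 2) - 67 ≤ Q n := by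
  have hn0 : (0 : ℝ) < n := by exact_mod_cast (by omega : 0 < n)
  have hb : (0 : ℝ) < 1 / (2 * n) := by positivity
  have hb4 : (0 : ℝ) < 1 / (4 * n) := by positivity
  have key : ∀ M : ℕ, n ≤ M →
      ∫ x in (0 : ℝ)..M, Real.exp (-(1 / (2 * n)) * x ^ 2) ≤ Q n + 67 := by
    intro M hM
    have hQ : Q n = ∑ m ∈ Finset.range M, qa n (m + 1) := by
      refine Finset.sum_subset (Finset.range_mono hM) fun m _ hm => ?_
      exact qa_of_lt (by simp at hm; omega)
    have h1 : ∑ m ∈ Finset.range M, (Real.exp (-(1 / (2 * n)) * ((m : ℝ) + 1) ^ 2) -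
        33 / √n * Real.exp (-(1 / (4 * n)) * ((m : ℝ) + 1) ^ 2)) ≤ Q n := by
      rw [hQ]
      refine Finset.sum_le_sum fun m _ => ?_
      have a1 := le_qa' hn (m + 1)
      have a2 := err_le (by omega : 0 < n) (m + 1)
      push_cast at a1 a2
      have a3 : -(((m : ℝ) + 1) ^ 2 / (2 * n)) = -(1 / (2 * n)) * ((m : ℝ) + 1) ^ 2 := by ring
      rw [a3] at a1 a2
      linarith
    rw [Finset.sum_sub_distrib, ← Finset.mul_sum] at h1
    have h2 := sum_gauss_le hb4 M
    have h3 : 33 / √n * (√(Real.pi / (1 / (4 * (n : ℝ)))) / 2) ≤ 66 := by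
      have e : Real.pi / (1 / (4 * (n : ℝ))) = Real.pi * 2 ^ 2 * n := by field_simp; norm_num
      rw [e, Real.sqrt_mul (by positivity), Real.sqrt_mul (by positivity), Real.sqrt_sq (by norm_num)]
      have hs : 0 < √(n : ℝ) := Real.sqrt_pos.2 hn0
      have hp : √Real.pi ≤ 2 := by
        rw [Real.sqrt_le_left (by norm_num)]
        linarith [Real.pi_le_four]
      field_simp
      linarith
    have h4 : 33 / √n * ∑ m ∈ Finset.range M, Real.exp (-(1 / (4 * n)) * ((m : ℝ) + 1) ^ 2) ≤ 66 :=
      le_trans (by gcongr) h3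
    have h5 := AntitoneOn.integral_le_sum (x₀ := 0) (a := M)
      (antitone_gauss hb (Set.Icc 0 (0 + (M : ℝ))) (fun x hx => hx.1))
    simp only [zero_add] at h5
    have h6 := Finset.sum_range_succ (fun m : ℕ => Real.exp (-(1 / (2 * (n : ℝ))) * (m : ℝ) ^ 2)) M
    rw [Finset.sum_range_succ'] at h6
    push_cast at h6
    simp only [ne_eq, OfNat.ofNat_ne_zero, not_false_eq_true, zero_pow, mul_zero, Real.exp_zero] at h6
    have h7 := Real.exp_pos (-(1 / (2 * (n : ℝ))) * (M : ℝ) ^ 2)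
    linarith
  have hlim := MeasureTheory.intervalIntegral_tendsto_integral_Ioi (0 : ℝ)
    (integrable_exp_neg_mul_sq hb).integrableOn (tendsto_natCast_atTop_atTop (R := ℝ))
  have h := le_of_tendsto hlim (Filter.eventually_atTop.2 ⟨n, key⟩)
  rw [integral_gaussian_Ioi] at h
  have h3 : √(Real.pi / (1 / (2 * (n : ℝ)))) / 2 = √(Real.pi * (n : ℝ) / 2) := by
    rw [div_eq_iff (by norm_num), eq_comm, ← Real.sqrt_sq (by norm_num : (0 : ℝ) ≤ 2),
      ← Real.sqrt_mul (by positivity), Real.sqrt_sq (by norm_num)]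
    congr 1
    field_simp
  rw [h3] at h
  linarith

/-- Rényi: `κ_n = √(2n/π) (1 + O(1/√n))`. -/
theorem renyi_kappa_asymp :
    ∃ C : ℝ, ∃ N : ℕ, ∀ n : ℕ, N ≤ n →
      |kappa n / Real.sqrt (2 * n / Real.pi) - 1| ≤ C / Real.sqrt n := by
  refine ⟨134, 20000, fun n hn => ?_⟩
  have hn0 : (0 : ℝ) < n := by exact_mod_cast (by omega : 0 < n)
  have hn1 : (20000 : ℝ) ≤ n := by exact_mod_cast hn
  have h1 := Q_le (by omega : 0 < n)
  have h2 := Q_ge (by omega : 8 ≤ n)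
  have hG : √(n : ℝ) ≤ √(Real.pi * n / 2) := by
    apply Real.sqrt_le_sqrt
    nlinarith [Real.pi_gt_three]
  have hs : (134 : ℝ) ≤ √(n : ℝ) := Real.le_sqrt_of_sq_le (by linarith)
  have hQ : √(n : ℝ) / 2 ≤ Q n := by linarith
  have hQ0 : 0 < Q n := by linarith
  have hmul : √(Real.pi * n / 2) * √(2 * n / Real.pi) = n := by
    rw [← Real.sqrt_mul (by positivity)]
    have : Real.pi * n / 2 * (2 * n / Real.pi) = (n : ℝ) ^ 2 := by
      field_simp
    rw [this, Real.sqrt_sq hn0.le]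
  have hr : 0 < √(2 * n / Real.pi) := Real.sqrt_pos.2 (by positivity)
  have e : kappa n / √(2 * n / Real.pi) - 1 = (√(Real.pi * n / 2) - Q n) / Q n := by
    rw [kappa_eq (by omega)]
    generalize √(2 * n / Real.pi) = r at *
    generalize √(Real.pi * n / 2) = G at *
    rw [← hmul]
    field_simp
  rw [e, abs_div, abs_of_pos hQ0]
  have h3 : |√(Real.pi * n / 2) - Q n| ≤ 67 := by
    rw [abs_le]
    constructor <;> linarith
  rw [div_le_div_iff₀ hQ0 (by linarith)]
  calc _ ≤ 67 * √(n : ℝ) := by gcongr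
    _ ≤ _ := by linarith

end IterMap
end

section
/- (Rubin–Sitgreaves) For every positive integer n and every m with 1 ≤ m ≤ n, the number of functions f ∈ Ω_n with exactly m cyclic vertices equals (n!/(n−m)!) · m · n^{n−m−1}; equivalently, P_n(Z = m) = n! · m / ((n−m)! · n^{m+1}). -/
open scoped Classical
open Function

namespace IterMap

/-- `f` has no nonempty closed subset. -/
def Acyc {α β : Type} (f : α → α ⊕ β) : Prop :=
  ∀ T : Set α, (∀ a ∈ T, ∃ b ∈ T, f a = Sum.inl b) → T = ∅

noncomputable def glue {α β : Type} (p : α → Prop) (h : {a // p a} → β)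
    (g : {a // ¬ p a} → {a // ¬ p a} ⊕ {a // p a}) : α → α ⊕ β :=
  fun a => if ha : p a then Sum.inr (h ⟨a, ha⟩)
    else Sum.inl (Sum.elim Subtype.val Subtype.val (g ⟨a, ha⟩))

theorem elim_inj {α : Type} {p : α → Prop} {x y : {a // ¬ p a} ⊕ {a // p a}}
    (h : Sum.elim Subtype.val Subtype.val x = (Sum.elim Subtype.val Subtype.val y : α)) :
    x = y := by
  rcases x with ⟨x, hx⟩ | ⟨x, hx⟩ <;> rcases y with ⟨y, hy⟩ | ⟨y, hy⟩ <;>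
    simp at h <;> subst h <;> first | rfl | exact absurd ‹p x› ‹¬ p x›

theorem elim_surj {α : Type} (p : α → Prop) (a : α) :
    ∃ x : {a // ¬ p a} ⊕ {a // p a}, Sum.elim Subtype.val Subtype.val x = a := by
  by_cases h : p a
  · exact ⟨Sum.inr ⟨a, h⟩, rfl⟩
  · exact ⟨Sum.inl ⟨a, h⟩, rfl⟩

theorem glue_acyc {α β : Type} (p : α → Prop) (h : {a // p a} → β)
    (g : {a // ¬ p a} → {a // ¬ p a} ⊕ {a // p a}) : Acyc (glue p h g) ↔ Acyc g := by
  constructor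
  · intro H T hT
    have := H (Subtype.val '' T) (by
      rintro _ ⟨a, ha, rfl⟩
      obtain ⟨b, hb, hab⟩ := hT a ha
      exact ⟨b, ⟨b, hb, rfl⟩, by simp [glue, a.2, hab]⟩)
    simpa using this
  · intro H T hT
    have hp : ∀ a ∈ T, ¬ p a := by
      intro a ha hpa
      obtain ⟨b, hb, hab⟩ := hT a ha
      simp [glue, hpa] at hab
    have := H (Subtype.val ⁻¹' T) (by
      rintro ⟨a, ha'⟩ ha
      obtain ⟨b, hb, hab⟩ := hT a ha
      refine ⟨⟨b, hp b hb⟩, hb, elim_inj ?_⟩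
      simpa [glue, ha'] using hab)
    ext a
    constructor
    · intro ha
      have : (⟨a, hp a ha⟩ : {a // ¬ p a}) ∈ (Subtype.val ⁻¹' T : Set {a // ¬ p a}) := ha
      simp_all
    · simp

theorem card_fiber_s9 {α β : Type} [Fintype α] [Fintype β] (p : α → Prop) :
    Nat.card {f : α → α ⊕ β // Acyc f ∧ ∀ a, p a ↔ (f a).isRight} =
      Nat.card ({a // p a} → β) *
      Nat.card {g : {a // ¬ p a} → {a // ¬ p a} ⊕ {a // p a} // Acyc g} := by
  rw [← Nat.card_prod]
  symm
  refine Nat.card_congr (Equiv.ofBijective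
    (fun x => ⟨glue p x.1 x.2.1, (glue_acyc _ _ _).2 x.2.2, fun a => ?_⟩) ⟨?_, ?_⟩)
  · by_cases ha : p a <;> simp [glue, ha]
  · rintro ⟨h, g, hg⟩ ⟨h', g', hg'⟩ H
    have H := congrArg Subtype.val H
    simp only at H
    have e1 : h = h' := by
      ext ⟨a, ha⟩
      have := congrFun H a
      simpa [glue, ha] using this
    have e2 : g = g' := by
      funext ⟨a, ha⟩
      have := congrFun H a
      apply elim_inj
      simpa [glue, ha] using this
    subst e1 e2
    rfl
  · rintro ⟨f, hf, hp⟩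
    have k1 : ∀ a : {a // p a}, ∃ b, f a = Sum.inr b := fun a =>
      Sum.isRight_iff.1 ((hp a).1 a.2)
    have k2 : ∀ a : {a // ¬ p a}, ∃ x : {a // ¬ p a} ⊕ {a // p a},
        f a = Sum.inl (Sum.elim Subtype.val Subtype.val x) := by
      intro a
      have : ¬ (f a).isRight := fun h => a.2 ((hp a).2 h)
      rw [Sum.not_isRight, Sum.isLeft_iff] at this
      obtain ⟨b, hb⟩ := this
      obtain ⟨x, hx⟩ := elim_surj p b
      exact ⟨x, by rw [hx, hb]⟩
    choose h hh using k1
    choose g hg using k2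
    have e : glue p h g = f := by
      funext a
      by_cases ha : p a
      · simp [glue, ha, ← hh ⟨a, ha⟩]
      · simp [glue, ha, ← hg ⟨a, ha⟩]
    exact ⟨(h, ⟨g, (glue_acyc p h g).1 (e ▸ hf)⟩), Subtype.ext e⟩

theorem card_split {X α : Type} [Fintype X] [Fintype α] (q : X → Prop) (P : X → α → Prop) :
    Nat.card {f : X // q f} =
      ∑ J : Finset α, Nat.card {f : X // q f ∧ ∀ a, a ∈ J ↔ P f a} := by
  rw [← Nat.card_sigma]
  refine (Nat.card_congr (Equiv.ofBijective
    (fun x => ⟨x.2.1, x.2.2.1⟩) ⟨?_, ?_⟩)).symm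
  · rintro ⟨J, f, hf, hJ⟩ ⟨J', f', hf', hJ'⟩ H
    have H : f = f' := congrArg Subtype.val H
    subst H
    have : J = J' := by ext a; rw [hJ, hJ']
    subst this
    rfl
  · rintro ⟨f, hf⟩
    exact ⟨⟨Finset.univ.filter (P f), f, hf, by simp⟩, rfl⟩

theorem sum_aux (k m : ℕ) :
    ∑ j ∈ Finset.range (k + 1 + 1), (k + 1).choose j * (m ^ j * (j * (k + 1) ^ (k + 1 - j))) =
      (k + 1) * (m * (k + 1 + m) ^ k) := by
  rw [Finset.sum_range_succ', add_comm (k + 1) m, add_pow m (k + 1) k, Finset.mul_sum, Finset.mul_sum]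
  simp only [zero_mul, mul_zero, add_zero]
  refine Finset.sum_congr rfl fun j _ => ?_
  have := Nat.add_one_mul_choose_eq k j
  rw [Nat.add_sub_add_right]
  calc _ = ((k+1).choose (j+1) * (j+1)) * (m ^ (j+1) * (k+1)^(k-j)) := by ring
    _ = _ := by rw [← this, Nat.cast_id]; ring

theorem acyc_count (k : ℕ) : ∀ (α β : Type) [Fintype α] [Fintype β], Fintype.card α = k →
    Nat.card {f : α → α ⊕ β // Acyc f} * (k + Fintype.card β) =
      Fintype.card β * (k + Fintype.card β) ^ k := by
  induction k using Nat.strong_induction_on with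
  | _ k ih =>
  intro α β _ _ hα
  rcases k with _ | k
  · have : IsEmpty α := Fintype.card_eq_zero_iff.1 hα
    have h1 : Nat.card {f : α → α ⊕ β // Acyc f} = 1 := by
      rw [Nat.card_eq_one_iff_unique]
      refine ⟨inferInstance, ⟨⟨isEmptyElim, fun T _ => ?_⟩⟩⟩
      exact Set.eq_empty_of_isEmpty T
    rw [h1]; simp
  · have key : Nat.card {f : α → α ⊕ β // Acyc f} * (k + 1) =
        (Fintype.card β * (k + 1 + Fintype.card β) ^ k) * (k + 1) := by
      rw [mul_comm _ (k+1), mul_comm _ (k+1), ← sum_aux, ← hα, ← Finset.card_univ (α := α), 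
        card_split _ (fun f a => (f a).isRight), Finset.mul_sum]
      have := Finset.sum_powerset_apply_card (fun j => Fintype.card β ^ j *
        (j * (Finset.univ : Finset α).card ^ ((Finset.univ : Finset α).card - j)))
        (x := (Finset.univ : Finset α))
      simp only [smul_eq_mul] at this
      rw [← this, Finset.powerset_univ]
      refine Finset.sum_congr rfl fun J _ => ?_
      rw [card_fiber_s9, Finset.card_univ, hα]
      have hJ : Fintype.card {a // a ∈ J} = J.card := Fintype.card_coe J
      have hle : J.card ≤ k + 1 := hα ▸ J.card_le_univ
      have hJc : Fintype.card {a // ¬ a ∈ J} = k + 1 - J.card := by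
        rw [Fintype.card_subtype_compl, hα, hJ]
      have hfun : Nat.card ({a // a ∈ J} → β) = Fintype.card β ^ J.card := by
        rw [Nat.card_eq_fintype_card, Fintype.card_fun, hJ]
      rw [hfun]
      have main : Nat.card {g : {a // ¬ a ∈ J} → {a // ¬ a ∈ J} ⊕ {a // a ∈ J} // Acyc g} * (k+1) =
          J.card * (k + 1) ^ (k + 1 - J.card) := by
        rcases Nat.eq_zero_or_pos J.card with h0 | hpos
        · have : J = ∅ := Finset.card_eq_zero.1 h0
          subst this
          have hem : IsEmpty {g : {a // ¬ a ∈ (∅ : Finset α)} →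
              {a // ¬ a ∈ (∅ : Finset α)} ⊕ {a // a ∈ (∅ : Finset α)} // Acyc g} := by
            refine ⟨fun ⟨g, hg⟩ => ?_⟩
            have hu := hg Set.univ (fun a _ => by
              rcases hga : g a with b | b
              · exact ⟨b, trivial, rfl⟩
              · exact absurd b.2 (Finset.notMem_empty _))
            obtain ⟨a⟩ : Nonempty α := Fintype.card_pos_iff.1 (by omega)
            have : (⟨a, by simp⟩ : {a // ¬ a ∈ (∅ : Finset α)}) ∈ (Set.univ : Set _) := trivial
            rw [hu] at this
            exact this
          simp [Nat.card_of_isEmpty]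
        · have := ih (k + 1 - J.card) (by omega) {a // ¬ a ∈ J} {a // a ∈ J} hJc
          rw [hJ, Nat.sub_add_cancel hle] at this
          exact this
      rw [← main]; ring
    have := Nat.eq_of_mul_eq_mul_right (Nat.succ_pos k) key
    rw [this]; ring

noncomputable def glue2 {α : Type} (p : α → Prop) (s : Equiv.Perm {a // p a})
    (g : {a // ¬ p a} → {a // ¬ p a} ⊕ {a // p a}) : α → α :=
  fun a => if ha : p a then (s ⟨a, ha⟩).1
    else Sum.elim Subtype.val Subtype.val (g ⟨a, ha⟩)

theorem glue2_iter {α : Type} (p : α → Prop) (s : Equiv.Perm {a // p a})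
    (g : {a // ¬ p a} → {a // ¬ p a} ⊕ {a // p a}) (t : ℕ) (a : {a // p a}) :
    (glue2 p s g)^[t] a.1 = ((s ^ t) a).1 := by
  induction t with
  | zero => rfl
  | succ t ih =>
    rw [Function.iterate_succ_apply', ih, pow_succ']
    simp [glue2, ((s ^ t) a).2]

theorem glue2_cyclic {n : ℕ} (p : Fin n → Prop) (s : Equiv.Perm {a // p a})
    (g : {a // ¬ p a} → {a // ¬ p a} ⊕ {a // p a}) (hg : Acyc g) (v : Fin n) :
    p v ↔ IsCyclic (glue2 p s g) v := by
  constructor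
  · intro hv
    refine ⟨orderOf s, orderOf_pos s, ?_⟩
    have := glue2_iter p s g (orderOf s) ⟨v, hv⟩
    simpa [pow_orderOf_eq_one] using this
  · rintro ⟨t, ht, hv⟩
    by_contra hpv
    set f := glue2 p s g with hf
    have hnot : ∀ i, ¬ p (f^[i] v) := by
      intro i hi
      have hfix : f^[t * (i + 1)] v = v := by
        rw [Function.iterate_mul]; exact Function.iterate_fixed hv _
      have hle : i ≤ t * (i + 1) := by nlinarith
      obtain ⟨d, hd⟩ := Nat.exists_eq_add_of_le' hle
      rw [hd, Function.iterate_add_apply] at hfix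
      have := glue2_iter p s g d ⟨_, hi⟩
      rw [← hf, hfix] at this
      exact hpv (this ▸ ((s ^ d) ⟨_, hi⟩).2)
    have hT := hg {x | ∃ i, f^[i] v = x.1} (by
      rintro ⟨x, hx⟩ ⟨i, hi⟩
      refine ⟨⟨f^[i+1] v, hnot (i+1)⟩, ⟨i+1, rfl⟩, elim_inj ?_⟩
      change _ = f^[i+1] v
      rw [Function.iterate_succ_apply', hi]
      simp [hf, glue2, hx])
    have : (⟨v, hpv⟩ : {a // ¬ p a}) ∈ {x : {a // ¬ p a} | ∃ i, f^[i] v = x.1} := ⟨0, rfl⟩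
    rw [hT] at this
    exact this

theorem card_fiber2 {n : ℕ} (p : Fin n → Prop) :
    Nat.card {f : Fin n → Fin n // ∀ a, p a ↔ IsCyclic f a} =
      Nat.card (Equiv.Perm {a // p a}) *
      Nat.card {g : {a // ¬ p a} → {a // ¬ p a} ⊕ {a // p a} // Acyc g} := by
  rw [← Nat.card_prod]
  symm
  refine Nat.card_congr (Equiv.ofBijective
    (fun x => ⟨glue2 p x.1 x.2.1, glue2_cyclic _ _ _ x.2.2⟩) ⟨?_, ?_⟩)
  · rintro ⟨h, g, hg⟩ ⟨h', g', hg'⟩ H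
    have H := congrArg Subtype.val H
    simp only at H
    have e1 : h = h' := by
      apply Equiv.ext
      rintro ⟨a, ha⟩
      have := congrFun H a
      apply Subtype.ext
      simpa [glue2, ha] using this
    have e2 : g = g' := by
      funext ⟨a, ha⟩
      have := congrFun H a
      apply elim_inj
      simpa [glue2, ha] using this
    subst e1 e2
    rfl
  · rintro ⟨f, hp⟩
    obtain rfl : p = IsCyclic f := funext fun a => propext (hp a)
    have k2 : ∀ a : {a // ¬ IsCyclic f a}, ∃ x : {a // ¬ IsCyclic f a} ⊕ {a // IsCyclic f a},
        Sum.elim Subtype.val Subtype.val x = f a := fun a => elim_surj _ _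
    choose g hg using k2
    have hac : Acyc g := by
      intro T hT
      by_contra hne
      obtain ⟨a, ha⟩ := Set.nonempty_iff_ne_empty.2 hne
      have hmem : ∀ i, ∃ x ∈ T, x.1 = f^[i] a.1 := by
        intro i
        induction i with
        | zero => exact ⟨a, ha, rfl⟩
        | succ i ih =>
          obtain ⟨x, hx, hxi⟩ := ih
          obtain ⟨b, hb, hgb⟩ := hT x hx
          refine ⟨b, hb, ?_⟩
          rw [Function.iterate_succ_apply', ← hxi, ← hg, hgb]
          rfl
      obtain ⟨i, j, hij, hf⟩ := Finite.exists_ne_map_eq_of_infinite (fun i : ℕ => f^[i] a.1)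
      have hcyc : ∀ i j : ℕ, i < j → f^[i] a.1 = f^[j] a.1 → False := by
        intro i j hij hf
        obtain ⟨x, hx, hxi⟩ := hmem i
        refine x.2 ⟨j - i, by omega, ?_⟩
        rw [hxi, ← Function.iterate_add_apply, Nat.sub_add_cancel hij.le, hf]
      rcases lt_or_gt_of_ne hij with h | h
      · exact hcyc i j h hf
      · exact hcyc j i h hf.symm
    refine ⟨(cyclicPerm f, ⟨g, hac⟩), Subtype.ext ?_⟩
    funext a
    by_cases ha : IsCyclic f a
    · simp [glue2, ha, cyclicPerm]
    · simp [glue2, ha, hg]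

theorem count_Z (n m : ℕ) (hmn : m ≤ n) :
    (Finset.univ.filter fun f : Fin n → Fin n => Z f = m).card * n =
      n.choose m * (m.factorial * (m * n ^ (n - m))) := by
  have h1 : (Finset.univ.filter fun f : Fin n → Fin n => Z f = m).card =
      Nat.card {f : Fin n → Fin n // Z f = m} := by
    rw [Nat.card_eq_fintype_card, Fintype.card_subtype]
  rw [h1, card_split _ (fun f a => IsCyclic f a), Finset.sum_mul]
  have h2 : ∀ J : Finset (Fin n),
      Nat.card {f : Fin n → Fin n // Z f = m ∧ ∀ a, a ∈ J ↔ IsCyclic f a} * n =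
      if J.card = m then m.factorial * (m * n ^ (n - m)) else 0 := by
    intro J
    have hZ : ∀ f : Fin n → Fin n, (∀ a, a ∈ J ↔ IsCyclic f a) → Z f = J.card := by
      intro f hf
      rw [Z, ← Fintype.card_coe J, ← Nat.card_eq_fintype_card]
      exact Nat.card_congr (Equiv.subtypeEquivRight fun a => (hf a).symm)
    split_ifs with hJ
    · have e : Nat.card {f : Fin n → Fin n // Z f = m ∧ ∀ a, a ∈ J ↔ IsCyclic f a} =
          Nat.card {f : Fin n → Fin n // ∀ a, a ∈ J ↔ IsCyclic f a} :=
        Nat.card_congr (Equiv.subtypeEquivRight fun f =>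
          ⟨fun h => h.2, fun h => ⟨(hZ f h).trans hJ, h⟩⟩)
      have hJ' : Fintype.card {a // a ∈ J} = m := (Fintype.card_coe J).trans hJ
      have hJc : Fintype.card {a // ¬ a ∈ J} = n - m := by
        rw [Fintype.card_subtype_compl, hJ', Fintype.card_fin]
      have := acyc_count (n - m) {a // ¬ a ∈ J} {a // a ∈ J} hJc
      rw [hJ', Nat.sub_add_cancel hmn] at this
      rw [e, card_fiber2, mul_assoc, this, Nat.card_eq_fintype_card, Fintype.card_perm, hJ']
    · have : IsEmpty {f : Fin n → Fin n // Z f = m ∧ ∀ a, a ∈ J ↔ IsCyclic f a} :=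
        ⟨fun ⟨f, h, h'⟩ => hJ ((hZ f h').symm.trans h)⟩
      simp [Nat.card_of_isEmpty]
  rw [Finset.sum_congr rfl fun J _ => h2 J, ← Finset.sum_filter, Finset.sum_const, smul_eq_mul]
  congr 1
  rw [Finset.univ_filter_card_eq, Finset.card_powersetCard, Finset.card_univ, Fintype.card_fin]

/-- Rubin–Sitgreaves: the distribution of the number of cyclic vertices. -/
theorem rubin_sitgreaves (n m : ℕ) (hm : 1 ≤ m) (hmn : m ≤ n) :
    ((Finset.univ.filter fun f : Fin n → Fin n => Z f = m).card : ℝ) =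
        ((n.factorial : ℝ) / ((n - m).factorial : ℝ)) * m *
          (n : ℝ) ^ ((n : ℤ) - (m : ℤ) - 1) ∧
      ((Finset.univ.filter fun f : Fin n → Fin n => Z f = m).card : ℝ) / (n : ℝ) ^ n =
        (n.factorial : ℝ) * m / (((n - m).factorial : ℝ) * (n : ℝ) ^ (m + 1)) := by
  have h := count_Z n m hmn
  have hn : (n : ℝ) ≠ 0 := by
    have : 0 < n := by omega
    positivity
  have hf : ((n - m).factorial : ℝ) ≠ 0 := by positivity
  have h' : ((Finset.univ.filter fun f : Fin n → Fin n => Z f = m).card : ℝ) * n =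
      (n.factorial : ℝ) / ((n - m).factorial : ℝ) * m * (n : ℝ) ^ (n - m) := by
    have hc : (n.choose m * m.factorial * (n - m).factorial : ℝ) = n.factorial := by
      exact_mod_cast Nat.choose_mul_factorial_mul_factorial hmn
    rw [← hc]
    have h2 : (((Finset.univ.filter fun f : Fin n → Fin n => Z f = m).card : ℝ)) * n =
      n.choose m * (m.factorial * (m * (n : ℝ) ^ (n - m))) := by exact_mod_cast h
    rw [h2]
    field_simp
  have h1 := eq_div_of_mul_eq hn h'
  constructor
  · rw [h1, zpow_sub₀ hn, ← Nat.cast_sub hmn, zpow_natCast, zpow_one]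
    ring
  · rw [h1]
    have hp : (n : ℝ) ^ n = (n : ℝ) ^ (n - m) * (n : ℝ) ^ m := by
      rw [← pow_add, Nat.sub_add_cancel hmn]
    rw [hp, pow_succ]
    field_simp

end IterMap
end
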